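/- Equip 𝒜^(2), 𝔄^(2) and (𝒜⋊𝔄)^(2) each with their first (respectively, each with their second) Arens products. Then 𝒜^(2) is a Banach 𝔄^(2)-bimodule with compatible actions under the canonical Arens-type extensions of the 𝔄-actions on 𝒜, and there is an isometric algebra isomorphism (𝒜⋊𝔄)^(2) ≅ 𝒜^(2) ⋊ 𝔄^(2). -/

import Mathlib

set_option maxSynthPendingDepth 5
set_option synthInstance.maxHeartbeats 1000000
set_option maxHeartbeats 4000000

noncomputable section

open ContinuousLinearMap

/-- `𝒜` is a Banach `𝔄`-bimodule with compatible actions: the left action `l` and right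
action `r` are continuous bilinear maps satisfying the module axioms and the
compatibility conditions `β·(ab) = (β·a)b`, `(ab)·β = a(b·β)`, `a(β·b) = (a·β)b`. -/
structure BiAction (A B : Type) [NonUnitalNormedRing A] [NormedSpace ℂ A]
    [IsScalarTower ℂ A A] [SMulCommClass ℂ A A]
    [NonUnitalNormedRing B] [NormedSpace ℂ B] [IsScalarTower ℂ B B] [SMulCommClass ℂ B B] :
    Type where
  l : B →L[ℂ] A →L[ℂ] A
  r : A →L[ℂ] B →L[ℂ] A
  l_mul : ∀ (β γ : B) (a : A), l (β * γ) a = l β (l γ a)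
  r_mul : ∀ (a : A) (β γ : B), r a (β * γ) = r (r a β) γ
  lr_assoc : ∀ (β : B) (a : A) (γ : B), r (l β a) γ = l β (r a γ)
  compat_l : ∀ (β : B) (a b : A), l β (a * b) = l β a * b
  compat_r : ∀ (a b : A) (β : B), r (a * b) β = a * r b β
  compat_m : ∀ (a : A) (β : B) (b : A), a * l β b = r a β * b

variable {A B : Type} [NonUnitalNormedRing A] [NormedSpace ℂ A]
    [IsScalarTower ℂ A A] [SMulCommClass ℂ A A]
    [NonUnitalNormedRing B] [NormedSpace ℂ B] [IsScalarTower ℂ B B] [SMulCommClass ℂ B B]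

/-- The multiplication of the amalgamated duplication `𝒜 ⋊ 𝔄`:
`(a, β)(b, γ) = (ab + a·γ + β·b, βγ)`. -/
def dupMul (σ : BiAction A B) (x y : A × B) : A × B :=
  (x.1 * y.1 + σ.r x.1 y.2 + σ.l x.2 y.1, x.2 * y.2)


section Arens

variable {X Y Z : Type} [NormedAddCommGroup X] [NormedSpace ℂ X]
  [NormedAddCommGroup Y] [NormedSpace ℂ Y] [NormedAddCommGroup Z] [NormedSpace ℂ Z]

/-- One step of the Arens-type dualization of a bounded bilinear map
`f : X × Y → Z`: `step f : Z' × X → Y'` is given by `⟨step f z' x, y⟩ = ⟨z', f x y⟩`. -/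
def step (f : X →L[ℂ] Y →L[ℂ] Z) :
    (Z →L[ℂ] ℂ) →L[ℂ] X →L[ℂ] (Y →L[ℂ] ℂ) :=
  ((ContinuousLinearMap.compL ℂ X (Y →L[ℂ] Z) (Y →L[ℂ] ℂ)).flip f).comp
    (ContinuousLinearMap.compL ℂ Y Z ℂ)

/-- The first Arens extension of a bounded bilinear map `f : X × Y → Z` to the biduals,
`arens1 f : X'' × Y'' → Z''`. -/
def arens1 (f : X →L[ℂ] Y →L[ℂ] Z) :
    ((X →L[ℂ] ℂ) →L[ℂ] ℂ) →L[ℂ] ((Y →L[ℂ] ℂ) →L[ℂ] ℂ) →L[ℂ] ((Z →L[ℂ] ℂ) →L[ℂ] ℂ) :=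
  step (step (step f))

/-- The second Arens extension of a bounded bilinear map `f : X × Y → Z` to the biduals. -/
def arens2 (f : X →L[ℂ] Y →L[ℂ] Z) :
    ((X →L[ℂ] ℂ) →L[ℂ] ℂ) →L[ℂ] ((Y →L[ℂ] ℂ) →L[ℂ] ℂ) →L[ℂ] ((Z →L[ℂ] ℂ) →L[ℂ] ℂ) :=
  (arens1 f.flip).flip

/-- `X''` is a Banach `Y''`-bimodule with compatible actions, where `mX, mY` are the
products and `l, r` the left and right actions. -/
def IsCompatBimodule {X Y : Type} [NormedAddCommGroup X] [NormedSpace ℂ X]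
    [NormedAddCommGroup Y] [NormedSpace ℂ Y]
    (mX : X →L[ℂ] X →L[ℂ] X) (mY : Y →L[ℂ] Y →L[ℂ] Y)
    (l : Y →L[ℂ] X →L[ℂ] X) (r : X →L[ℂ] Y →L[ℂ] X) : Prop :=
  (∀ (w w' : Y) (u : X), l (mY w w') u = l w (l w' u)) ∧
  (∀ (u : X) (w w' : Y), r u (mY w w') = r (r u w) w') ∧
  (∀ (w : Y) (u : X) (w' : Y), r (l w u) w' = l w (r u w')) ∧
  (∀ (w : Y) (u u' : X), l w (mX u u') = mX (l w u) u') ∧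
  (∀ (u u' : X) (w : Y), r (mX u u') w = mX u (r u' w)) ∧
  (∀ (u : X) (w : Y) (u' : X), mX u (l w u') = mX (r u w) u')

end Arens

variable [CompleteSpace A] [CompleteSpace B]

/-- The multiplication of `𝒜 ⋊ 𝔄` as a continuous bilinear map on `𝒜 × 𝔄`. -/
def mulPair (σ : BiAction A B) : (A × B) →L[ℂ] (A × B) →L[ℂ] (A × B) :=
  ((ContinuousLinearMap.prodₗᵢ (F := A) (G := B) (E := A × B)
      ℂ).toContinuousLinearEquiv.toContinuousLinearMap).comp
    ((((ContinuousLinearMap.mul ℂ A).bilinearComp (ContinuousLinearMap.fst ℂ A B)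
        (ContinuousLinearMap.fst ℂ A B) +
      σ.r.bilinearComp (ContinuousLinearMap.fst ℂ A B) (ContinuousLinearMap.snd ℂ A B) +
      σ.l.bilinearComp (ContinuousLinearMap.snd ℂ A B) (ContinuousLinearMap.fst ℂ A B)).prod
      ((ContinuousLinearMap.mul ℂ B).bilinearComp (ContinuousLinearMap.snd ℂ A B)
        (ContinuousLinearMap.snd ℂ A B))))

/-- The amalgamated duplication `𝒜 ⋊ 𝔄` as a Banach space: `𝒜 × 𝔄` with the `ℓ¹`-norm
`‖(a, β)‖ = ‖a‖ + ‖β‖`. -/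
abbrev Dup1 (_σ : BiAction A B) : Type := WithLp 1 (A × B)

/-- The multiplication of `𝒜 ⋊ 𝔄` as a continuous bilinear map on `Dup1 σ`. -/
def mulDup1 (σ : BiAction A B) : Dup1 σ →L[ℂ] Dup1 σ →L[ℂ] Dup1 σ :=
  ((ContinuousLinearMap.compL ℂ (Dup1 σ) (A × B) (Dup1 σ))
      (WithLp.prodContinuousLinearEquiv 1 ℂ A B).symm.toContinuousLinearMap).comp
    ((mulPair σ).bilinearComp
      (WithLp.prodContinuousLinearEquiv 1 ℂ A B).toContinuousLinearMap
      (WithLp.prodContinuousLinearEquiv 1 ℂ A B).toContinuousLinearMap)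

section ArensLemmas

variable {X Y Z U V W : Type} [NormedAddCommGroup X] [NormedSpace ℂ X]
  [NormedAddCommGroup Y] [NormedSpace ℂ Y] [NormedAddCommGroup Z] [NormedSpace ℂ Z]
  [NormedAddCommGroup U] [NormedSpace ℂ U] [NormedAddCommGroup V] [NormedSpace ℂ V]
  [NormedAddCommGroup W] [NormedSpace ℂ W]

/-- The second transpose of a bounded linear map. -/
def bidualMap (p : X →L[ℂ] Y) :
    ((X →L[ℂ] ℂ) →L[ℂ] ℂ) →L[ℂ] ((Y →L[ℂ] ℂ) →L[ℂ] ℂ) :=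
  ContinuousLinearMap.precomp ℂ (ContinuousLinearMap.precomp ℂ p)

@[simp]
theorem bidualMap_apply (p : X →L[ℂ] Y) (u : (X →L[ℂ] ℂ) →L[ℂ] ℂ) (ψ : Y →L[ℂ] ℂ) :
    bidualMap p u ψ = u (ψ.comp p) := rfl

theorem arens1_assoc {f : X →L[ℂ] Y →L[ℂ] Z} {g : Z →L[ℂ] W →L[ℂ] V}
    {h : Y →L[ℂ] W →L[ℂ] U} {k : X →L[ℂ] U →L[ℂ] V}
    (H : ∀ x y w, g (f x y) w = k x (h y w))
    (u : (X →L[ℂ] ℂ) →L[ℂ] ℂ) (v : (Y →L[ℂ] ℂ) →L[ℂ] ℂ) (w : (W →L[ℂ] ℂ) →L[ℂ] ℂ) :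
    arens1 g (arens1 f u v) w = arens1 k u (arens1 h v w) := by
  ext φ
  refine congrArg u (ContinuousLinearMap.ext fun x => ?_)
  refine congrArg v (ContinuousLinearMap.ext fun y => ?_)
  exact congrArg w (ContinuousLinearMap.ext fun z => congrArg φ (H x y z))

theorem arens2_assoc {f : X →L[ℂ] Y →L[ℂ] Z} {g : Z →L[ℂ] W →L[ℂ] V}
    {h : Y →L[ℂ] W →L[ℂ] U} {k : X →L[ℂ] U →L[ℂ] V}
    (H : ∀ x y w, g (f x y) w = k x (h y w))
    (u : (X →L[ℂ] ℂ) →L[ℂ] ℂ) (v : (Y →L[ℂ] ℂ) →L[ℂ] ℂ) (w : (W →L[ℂ] ℂ) →L[ℂ] ℂ) :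
    arens2 g (arens2 f u v) w = arens2 k u (arens2 h v w) :=
  (arens1_assoc (f := h.flip) (g := k.flip) (h := f.flip) (k := g.flip)
    (fun w y x => (H x y w).symm) w v u).symm

theorem arens1_add (f g : X →L[ℂ] Y →L[ℂ] Z)
    (u : (X →L[ℂ] ℂ) →L[ℂ] ℂ) (v : (Y →L[ℂ] ℂ) →L[ℂ] ℂ) :
    arens1 (f + g) u v = arens1 f u v + arens1 g u v := by
  ext φ
  refine Eq.trans (congrArg u (ContinuousLinearMap.ext fun x => ?_)) (map_add u _ _)
  refine Eq.trans (congrArg v (ContinuousLinearMap.ext fun y => ?_)) (map_add v _ _)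
  exact map_add φ _ _

theorem arens2_add (f g : X →L[ℂ] Y →L[ℂ] Z)
    (u : (X →L[ℂ] ℂ) →L[ℂ] ℂ) (v : (Y →L[ℂ] ℂ) →L[ℂ] ℂ) :
    arens2 (f + g) u v = arens2 f u v + arens2 g u v :=
  arens1_add f.flip g.flip v u

theorem arens1_bilinearComp (f : X →L[ℂ] Y →L[ℂ] Z) (p : U →L[ℂ] X) (q : V →L[ℂ] Y)
    (u : (U →L[ℂ] ℂ) →L[ℂ] ℂ) (v : (V →L[ℂ] ℂ) →L[ℂ] ℂ) :
    arens1 (f.bilinearComp p q) u v = arens1 f (bidualMap p u) (bidualMap q v) := rfl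

theorem arens2_bilinearComp (f : X →L[ℂ] Y →L[ℂ] Z) (p : U →L[ℂ] X) (q : V →L[ℂ] Y)
    (u : (U →L[ℂ] ℂ) →L[ℂ] ℂ) (v : (V →L[ℂ] ℂ) →L[ℂ] ℂ) :
    arens2 (f.bilinearComp p q) u v = arens2 f (bidualMap p u) (bidualMap q v) := rfl

theorem bidualMap_arens1 {f : X →L[ℂ] Y →L[ℂ] Z} {p : Z →L[ℂ] W} {g : X →L[ℂ] Y →L[ℂ] W}
    (H : ∀ x y, p (f x y) = g x y)
    (u : (X →L[ℂ] ℂ) →L[ℂ] ℂ) (v : (Y →L[ℂ] ℂ) →L[ℂ] ℂ) :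
    bidualMap p (arens1 f u v) = arens1 g u v := by
  ext φ
  refine congrArg u (ContinuousLinearMap.ext fun x => ?_)
  exact congrArg v (ContinuousLinearMap.ext fun y => congrArg φ (H x y))

theorem bidualMap_arens2 {f : X →L[ℂ] Y →L[ℂ] Z} {p : Z →L[ℂ] W} {g : X →L[ℂ] Y →L[ℂ] W}
    (H : ∀ x y, p (f x y) = g x y)
    (u : (X →L[ℂ] ℂ) →L[ℂ] ℂ) (v : (Y →L[ℂ] ℂ) →L[ℂ] ℂ) :
    bidualMap p (arens2 f u v) = arens2 g u v :=
  bidualMap_arens1 (f := f.flip) (g := g.flip) (fun y x => H x y) v u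

end ArensLemmas

section BidualProd

open WithLp (fstL sndL)

variable {E F : Type} [NormedAddCommGroup E] [NormedSpace ℂ E]
  [NormedAddCommGroup F] [NormedSpace ℂ F]

variable (E F) in
/-- The first inclusion into the `ℓ¹`-product. -/
def inlL1 : E →L[ℂ] WithLp 1 (E × F) :=
  (WithLp.prodContinuousLinearEquiv 1 ℂ E F).symm.toContinuousLinearMap.comp
    (ContinuousLinearMap.inl ℂ E F)

variable (E F) in
/-- The second inclusion into the `ℓ¹`-product. -/
def inrL1 : F →L[ℂ] WithLp 1 (E × F) :=
  (WithLp.prodContinuousLinearEquiv 1 ℂ E F).symm.toContinuousLinearMap.comp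
    (ContinuousLinearMap.inr ℂ E F)

theorem norm_eq_fstL_add_sndL (x : WithLp 1 (E × F)) :
    ‖x‖ = ‖fstL 1 ℂ E F x‖ + ‖sndL 1 ℂ E F x‖ :=
  WithLp.prod_norm_eq_of_L1 x

theorem dual_eq_comp_fstL_add_comp_sndL (φ : WithLp 1 (E × F) →L[ℂ] ℂ) :
    φ = (φ.comp (inlL1 E F)).comp (fstL 1 ℂ E F) + (φ.comp (inrL1 E F)).comp (sndL 1 ℂ E F) := by
  ext x
  refine Eq.trans (congrArg φ ?_) (map_add φ _ _)
  apply (WithLp.prodContinuousLinearEquiv 1 ℂ E F).injective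
  ext <;> simp [inlL1, inrL1]

theorem norm_comp_inlL1_le (φ : WithLp 1 (E × F) →L[ℂ] ℂ) : ‖φ.comp (inlL1 E F)‖ ≤ ‖φ‖ := by
  refine ContinuousLinearMap.opNorm_le_bound _ (norm_nonneg _) fun x => ?_
  refine (φ.le_opNorm _).trans_eq ?_
  rw [norm_eq_fstL_add_sndL]
  simp [inlL1]

theorem norm_comp_inrL1_le (φ : WithLp 1 (E × F) →L[ℂ] ℂ) : ‖φ.comp (inrL1 E F)‖ ≤ ‖φ‖ := by
  refine ContinuousLinearMap.opNorm_le_bound _ (norm_nonneg _) fun x => ?_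
  refine (φ.le_opNorm _).trans_eq ?_
  rw [norm_eq_fstL_add_sndL]
  simp [inrL1]

theorem norm_comp_fstL_add_comp_sndL_le {φ : E →L[ℂ] ℂ} {ψ : F →L[ℂ] ℂ} {c : ℝ}
    (hφ : ‖φ‖ ≤ c) (hψ : ‖ψ‖ ≤ c) : ‖φ.comp (fstL 1 ℂ E F) + ψ.comp (sndL 1 ℂ E F)‖ ≤ c := by
  refine ContinuousLinearMap.opNorm_le_bound _ ((norm_nonneg _).trans hφ) fun x => ?_
  rw [norm_eq_fstL_add_sndL, mul_add]
  exact (norm_add_le _ _).trans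
    (add_le_add (φ.le_of_opNorm_le hφ _) (ψ.le_of_opNorm_le hψ _))

theorem norm_apply_add_norm_apply_le (u : (WithLp 1 (E × F) →L[ℂ] ℂ) →L[ℂ] ℂ)
    {φ : E →L[ℂ] ℂ} {ψ : F →L[ℂ] ℂ} (hφ : ‖φ‖ ≤ 1) (hψ : ‖ψ‖ ≤ 1) :
    ‖bidualMap (fstL 1 ℂ E F) u φ‖ + ‖bidualMap (sndL 1 ℂ E F) u ψ‖ ≤ ‖u‖ := by
  obtain ⟨a, ha, ha'⟩ := RCLike.exists_norm_eq_mul_self (bidualMap (fstL 1 ℂ E F) u φ)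
  obtain ⟨b, hb, hb'⟩ := RCLike.exists_norm_eq_mul_self (bidualMap (sndL 1 ℂ E F) u ψ)
  have key : u ((a • φ).comp (fstL 1 ℂ E F) + (b • ψ).comp (sndL 1 ℂ E F)) =
      ((‖bidualMap (fstL 1 ℂ E F) u φ‖ + ‖bidualMap (sndL 1 ℂ E F) u ψ‖ : ℝ) : ℂ) := by
    push_cast
    refine Eq.trans ?_ (congrArg₂ (· + ·) ha'.symm hb'.symm)
    simp [ContinuousLinearMap.smul_comp]
  have h := u.le_opNorm_of_le (norm_comp_fstL_add_comp_sndL_le (φ := a • φ) (ψ := b • ψ)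
    (c := 1) (by simpa [norm_smul, ha] using hφ) (by simpa [norm_smul, hb] using hψ))
  rw [key, Complex.norm_real, Real.norm_of_nonneg (by positivity), mul_one] at h
  exact h

theorem norm_bidualMap_fstL_add_norm_bidualMap_sndL
    (u : (WithLp 1 (E × F) →L[ℂ] ℂ) →L[ℂ] ℂ) :
    ‖bidualMap (fstL 1 ℂ E F) u‖ + ‖bidualMap (sndL 1 ℂ E F) u‖ = ‖u‖ := by
  apply le_antisymm
  · have h₁ : ∀ ψ : F →L[ℂ] ℂ, ‖ψ‖ ≤ 1 →
        ‖bidualMap (fstL 1 ℂ E F) u‖ ≤ ‖u‖ - ‖bidualMap (sndL 1 ℂ E F) u ψ‖ := fun ψ hψ => by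
      refine ContinuousLinearMap.opNorm_le_of_unit_norm ?_ fun φ hφ => ?_
      · have := norm_apply_add_norm_apply_le u (φ := 0) (by simp) hψ
        have := norm_nonneg (bidualMap (fstL 1 ℂ E F) u 0)
        linarith
      · linarith [norm_apply_add_norm_apply_le u hφ.le hψ]
    have h₂ : ‖bidualMap (sndL 1 ℂ E F) u‖ ≤ ‖u‖ - ‖bidualMap (fstL 1 ℂ E F) u‖ := by
      refine ContinuousLinearMap.opNorm_le_of_unit_norm ?_ fun ψ hψ => ?_
      · have := h₁ 0 (by simp)
        have := norm_nonneg (bidualMap (sndL 1 ℂ E F) u 0)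
        linarith
      · linarith [h₁ ψ hψ.le]
    linarith
  · refine ContinuousLinearMap.opNorm_le_bound _ (by positivity) fun φ => ?_
    have h : u φ = bidualMap (fstL 1 ℂ E F) u (φ.comp (inlL1 E F)) +
        bidualMap (sndL 1 ℂ E F) u (φ.comp (inrL1 E F)) := by
      conv_lhs => rw [dual_eq_comp_fstL_add_comp_sndL φ]
      exact map_add u _ _
    rw [h, add_mul]
    exact (norm_add_le _ _).trans (add_le_add
      (ContinuousLinearMap.le_opNorm_of_le _ (norm_comp_inlL1_le φ))
      (ContinuousLinearMap.le_opNorm_of_le _ (norm_comp_inrL1_le φ)))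

variable (E F) in
/-- The bidual of an `ℓ¹`-product is isometrically the `ℓ¹`-product of the biduals. -/
def bidualProdL1 : ((WithLp 1 (E × F) →L[ℂ] ℂ) →L[ℂ] ℂ) ≃ₗᵢ[ℂ]
    WithLp 1 (((E →L[ℂ] ℂ) →L[ℂ] ℂ) × ((F →L[ℂ] ℂ) →L[ℂ] ℂ)) where
  toFun u := WithLp.toLp 1 (bidualMap (fstL 1 ℂ E F) u, bidualMap (sndL 1 ℂ E F) u)
  invFun w := bidualMap (inlL1 E F) w.fst + bidualMap (inrL1 E F) w.snd
  map_add' u v := by simp only [map_add]; rfl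
  map_smul' c u := by simp only [map_smul]; rfl
  left_inv u := by
    ext φ
    conv_rhs => rw [dual_eq_comp_fstL_add_comp_sndL φ]
    exact (map_add u _ _).symm
  right_inv w := by
    apply (WithLp.equiv 1 _).injective
    refine Prod.ext (ContinuousLinearMap.ext fun φ => ?_) (ContinuousLinearMap.ext fun φ => ?_)
    · have h₁ : (φ.comp (fstL 1 ℂ E F)).comp (inlL1 E F) = φ := rfl
      have h₂ : (φ.comp (fstL 1 ℂ E F)).comp (inrL1 E F) = 0 :=
        ContinuousLinearMap.ext fun _ => map_zero φ
      change w.fst ((φ.comp (fstL 1 ℂ E F)).comp (inlL1 E F)) +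
        w.snd ((φ.comp (fstL 1 ℂ E F)).comp (inrL1 E F)) = w.fst φ
      rw [h₁, h₂, map_zero, add_zero]
    · have h₁ : (φ.comp (sndL 1 ℂ E F)).comp (inlL1 E F) = 0 :=
        ContinuousLinearMap.ext fun _ => map_zero φ
      have h₂ : (φ.comp (sndL 1 ℂ E F)).comp (inrL1 E F) = φ := rfl
      change w.fst ((φ.comp (sndL 1 ℂ E F)).comp (inlL1 E F)) +
        w.snd ((φ.comp (sndL 1 ℂ E F)).comp (inrL1 E F)) = w.snd φ
      rw [h₁, h₂, map_zero, zero_add]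
  norm_map' u :=
    (WithLp.prod_norm_eq_of_L1 _).trans (norm_bidualMap_fstL_add_norm_bidualMap_sndL u)

end BidualProd

theorem fstL_mulDup1 (σ : BiAction A B) (x y : Dup1 σ) :
    WithLp.fstL 1 ℂ A B (mulDup1 σ x y) =
      ((ContinuousLinearMap.mul ℂ A).bilinearComp (WithLp.fstL 1 ℂ A B) (WithLp.fstL 1 ℂ A B) +
        σ.r.bilinearComp (WithLp.fstL 1 ℂ A B) (WithLp.sndL 1 ℂ A B) +
        σ.l.bilinearComp (WithLp.sndL 1 ℂ A B) (WithLp.fstL 1 ℂ A B)) x y := rfl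

theorem sndL_mulDup1 (σ : BiAction A B) (x y : Dup1 σ) :
    WithLp.sndL 1 ℂ A B (mulDup1 σ x y) =
      (ContinuousLinearMap.mul ℂ B).bilinearComp (WithLp.sndL 1 ℂ A B)
        (WithLp.sndL 1 ℂ A B) x y := rfl


/-- With `𝒜^(2)`, `𝔄^(2)` and `(𝒜 ⋊ 𝔄)^(2)` equipped with their first
(respectively, second) Arens products, `𝒜^(2)` is a Banach `𝔄^(2)`-bimodule with compatible
actions via the Arens-type extensions of the actions of `𝔄` on `𝒜`, and
`(𝒜 ⋊ 𝔄)^(2) ≅ 𝒜^(2) ⋊ 𝔄^(2)` isometrically and multiplicatively. -/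
theorem bidual_dup_iso (σ : BiAction A B) :
    -- `𝒜^(2)` is a Banach `𝔄^(2)`-bimodule with compatible actions (first Arens products)
    IsCompatBimodule (arens1 (ContinuousLinearMap.mul ℂ A))
      (arens1 (ContinuousLinearMap.mul ℂ B)) (arens1 σ.l) (arens1 σ.r) ∧
    -- likewise for the second Arens products
    IsCompatBimodule (arens2 (ContinuousLinearMap.mul ℂ A))
      (arens2 (ContinuousLinearMap.mul ℂ B)) (arens2 σ.l) (arens2 σ.r) ∧
    -- `(𝒜 ⋊ 𝔄)^(2) ≅ 𝒜^(2) ⋊ 𝔄^(2)` isometrically, carrying the first Arens product of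
    -- `(𝒜 ⋊ 𝔄)^(2)` to the duplication product of `𝒜^(2) ⋊ 𝔄^(2)` (with `ℓ¹`-norm)
    (∃ Φ : ((Dup1 σ →L[ℂ] ℂ) →L[ℂ] ℂ) ≃ₗᵢ[ℂ]
        WithLp 1 ((((A →L[ℂ] ℂ) →L[ℂ] ℂ) × ((B →L[ℂ] ℂ) →L[ℂ] ℂ))),
      ∀ u v : (Dup1 σ →L[ℂ] ℂ) →L[ℂ] ℂ,
        WithLp.equiv 1 _ (Φ (arens1 (mulDup1 σ) u v)) =
          (arens1 (ContinuousLinearMap.mul ℂ A) (WithLp.equiv 1 _ (Φ u)).1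
              (WithLp.equiv 1 _ (Φ v)).1 +
            arens1 σ.r (WithLp.equiv 1 _ (Φ u)).1 (WithLp.equiv 1 _ (Φ v)).2 +
            arens1 σ.l (WithLp.equiv 1 _ (Φ u)).2 (WithLp.equiv 1 _ (Φ v)).1,
           arens1 (ContinuousLinearMap.mul ℂ B) (WithLp.equiv 1 _ (Φ u)).2
              (WithLp.equiv 1 _ (Φ v)).2)) ∧
    -- and likewise for the second Arens products
    (∃ Φ : ((Dup1 σ →L[ℂ] ℂ) →L[ℂ] ℂ) ≃ₗᵢ[ℂ]
        WithLp 1 ((((A →L[ℂ] ℂ) →L[ℂ] ℂ) × ((B →L[ℂ] ℂ) →L[ℂ] ℂ))),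
      ∀ u v : (Dup1 σ →L[ℂ] ℂ) →L[ℂ] ℂ,
        WithLp.equiv 1 _ (Φ (arens2 (mulDup1 σ) u v)) =
          (arens2 (ContinuousLinearMap.mul ℂ A) (WithLp.equiv 1 _ (Φ u)).1
              (WithLp.equiv 1 _ (Φ v)).1 +
            arens2 σ.r (WithLp.equiv 1 _ (Φ u)).1 (WithLp.equiv 1 _ (Φ v)).2 +
            arens2 σ.l (WithLp.equiv 1 _ (Φ u)).2 (WithLp.equiv 1 _ (Φ v)).1,
           arens2 (ContinuousLinearMap.mul ℂ B) (WithLp.equiv 1 _ (Φ u)).2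
              (WithLp.equiv 1 _ (Φ v)).2)) := by
  refine ⟨⟨?_, ?_, ?_, ?_, ?_, ?_⟩, ⟨?_, ?_, ?_, ?_, ?_, ?_⟩, ⟨bidualProdL1 A B, fun u v => ?_⟩,
    ⟨bidualProdL1 A B, fun u v => ?_⟩⟩
  · exact arens1_assoc σ.l_mul
  · exact fun u w w' => (arens1_assoc (fun a β γ => (σ.r_mul a β γ).symm) u w w').symm
  · exact arens1_assoc σ.lr_assoc
  · exact fun w u u' => (arens1_assoc (fun β a b => (σ.compat_l β a b).symm) w u u').symm
  · exact arens1_assoc σ.compat_r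
  · exact fun u w u' => (arens1_assoc (fun a β b => (σ.compat_m a β b).symm) u w u').symm
  · exact arens2_assoc σ.l_mul
  · exact fun u w w' => (arens2_assoc (fun a β γ => (σ.r_mul a β γ).symm) u w w').symm
  · exact arens2_assoc σ.lr_assoc
  · exact fun w u u' => (arens2_assoc (fun β a b => (σ.compat_l β a b).symm) w u u').symm
  · exact arens2_assoc σ.compat_r
  · exact fun u w u' => (arens2_assoc (fun a β b => (σ.compat_m a β b).symm) u w u').symm
  · refine Prod.ext ?_ (bidualMap_arens1 (sndL_mulDup1 σ) u v)
    refine (bidualMap_arens1 (fstL_mulDup1 σ) u v).trans ?_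
    rw [arens1_add, arens1_add]
    rfl
  · refine Prod.ext ?_ (bidualMap_arens2 (sndL_mulDup1 σ) u v)
    refine (bidualMap_arens2 (fstL_mulDup1 σ) u v).trans ?_
    rw [arens2_add, arens2_add]
    rfl

end
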